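/- Let ι be a finite type, let w : ι → ℝ with w(j) ≥ 0 for all j, and let B ∈ ℝ with B ≥ 0. Define a DFA with state set Option (Finset ι), start state some ∅, transition δ(some S, j) = some (insert j S) if j ∉ S and (Σ_{i ∈ S} w(i)) + w(j) ≤ B, δ(some S, j) = none otherwise, δ(none, j) = none, and accepting states {some S : S a finite subset of ι}. Then the accepted language of this DFA is exactly the set of duplicate-free lists ℓ over ι with Σ_{j ∈ ℓ} w(j) ≤ B. -/

import Mathlib

open Classical in
/-- The knapsack DFA: states are `Option (Finset ι)` where `some S` records the set of
items already selected and `none` is the absorbing sink; the start state is `some ∅`;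
from `some S`, selecting item `j` is allowed iff `j ∉ S` and the total weight including
`w j` stays within the capacity `B`; every state `some S` is accepting. -/
noncomputable def knapsackDFA (ι : Type) [Fintype ι] (w : ι → ℝ) (B : ℝ) :
    DFA ι (Option (Finset ι)) where
  step q j :=
    match q with
    | none => none
    | some S => if j ∉ S ∧ (∑ i ∈ S, w i) + w j ≤ B then some (insert j S) else none
  start := some ∅
  accept := {q | ∃ S : Finset ι, q = some S}

theorem knapsackDFA_step_none (ι : Type) [Fintype ι] (w : ι → ℝ) (B : ℝ) (j : ι) :
    (knapsackDFA ι w B).step none j = none := rfl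

open Classical in
theorem knapsackDFA_step_some (ι : Type) [Fintype ι] (w : ι → ℝ) (B : ℝ) (S : Finset ι)
    (j : ι) : (knapsackDFA ι w B).step (some S) j =
      if j ∉ S ∧ (∑ i ∈ S, w i) + w j ≤ B then some (insert j S) else none := rfl

theorem knapsackDFA_evalFrom_none (ι : Type) [Fintype ι] (w : ι → ℝ) (B : ℝ) (ℓ : List ι) :
    (knapsackDFA ι w B).evalFrom none ℓ = none := by
  induction ℓ with
  | nil => rfl
  | cons j ℓ ih => rw [DFA.evalFrom_cons, knapsackDFA_step_none, ih]

/-- Starting from a feasible selection `S`, the knapsack DFA avoids the sink on `ℓ` exactly when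
`ℓ` extends `S` to a feasible selection without repetition. -/
theorem knapsackDFA_evalFrom_some_isSome (ι : Type) [Fintype ι] (w : ι → ℝ)
    (hw : ∀ j, 0 ≤ w j) (B : ℝ) (ℓ : List ι) (S : Finset ι) (hS : ∑ i ∈ S, w i ≤ B) :
    (∃ T, (knapsackDFA ι w B).evalFrom (some S) ℓ = some T) ↔
      ℓ.Nodup ∧ (∀ j ∈ ℓ, j ∉ S) ∧ (∑ i ∈ S, w i) + (ℓ.map w).sum ≤ B := by
  classical
  induction ℓ generalizing S with
  | nil => simpa using hS
  | cons j ℓ ih =>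
    rw [DFA.evalFrom_cons, knapsackDFA_step_some]
    have hnonneg : 0 ≤ (ℓ.map w).sum := List.sum_nonneg (by simpa using fun i _ => hw i)
    split_ifs with h
    · have hsum : ∑ i ∈ insert j S, w i = (∑ i ∈ S, w i) + w j := by
        rw [Finset.sum_insert h.1, add_comm]
      rw [ih _ (hsum.trans_le h.2), hsum, List.map_cons, List.sum_cons, List.nodup_cons,
        ← add_assoc]
      simp only [Finset.mem_insert, List.mem_cons]
      grind
    · rw [knapsackDFA_evalFrom_none]
      simp only [reduceCtorEq, exists_false, false_iff, List.map_cons, List.sum_cons]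
      rintro ⟨-, hdisj, hle⟩
      exact h ⟨hdisj j List.mem_cons_self, by linarith⟩

/-- For a finite type `ι`, nonnegative weights `w : ι → ℝ`, and capacity `B ≥ 0`, the
accepted language of the knapsack DFA is exactly the set of duplicate-free lists over `ι`
whose total weight is at most `B`. -/
theorem knapsackDFA_accepts
    (ι : Type) [Fintype ι] (w : ι → ℝ) (hw : ∀ j, 0 ≤ w j) (B : ℝ) (hB : 0 ≤ B) :
    ∀ ℓ : List ι,
      ℓ ∈ (knapsackDFA ι w B).accepts ↔ (ℓ.Nodup ∧ (ℓ.map w).sum ≤ B) := by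
  intro ℓ
  have h := knapsackDFA_evalFrom_some_isSome ι w hw B ℓ ∅ (by simpa using hB)
  simp only [Finset.notMem_empty, not_false_eq_true, implies_true, true_and,
    Finset.sum_empty, zero_add] at h
  exact h
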